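/- arXiv:1405.6310 — 3 statements merged into one kernel-verified Lean document; each statement's English description precedes it below -/
import Mathlib

section
/- Let G be a hyperbolic group with finite generating sets A and A', with hyperbolicity constants δ and δ' for d_A and d_{A'} respectively, and let γ, γ' > 0 satisfy γδ ≤ ln 2 and γ'δ' ≤ ln 2, so that d = σ^A_{p,γ} and d' = σ^{A'}_{p',γ'} are visual metrics on G. Let φ : G → G be a group homomorphism with Gφ ≠ {1}, and let r > 0. Then the following are equivalent: (i) φ satisfies a Hölder condition of exponent r as a map from (G,d) to (G,d'); (ii) there exists a constant Q ∈ ℝ such that (γ'/(rγ))·(gφ|hφ)^{A'}_{p'} + Q ≥ (g|h)^A_p for all g,h ∈ G. -/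
open scoped Classical

section Defs

variable {G : Type*}

/-- Word length of `g` with respect to a generating set `A`: the least `n` such that
`g` is a product of `n` elements of `A ∪ A⁻¹`. -/
noncomputable def wordLength [Group G] (A : Set G) (g : G) : ℕ :=
  sInf {n : ℕ | ∃ w : List G, w.length = n ∧ (∀ x ∈ w, x ∈ A ∨ x⁻¹ ∈ A) ∧ w.prod = g}

/-- The word metric `d_A(g,h)` (as a real number). -/
noncomputable def wordDist [Group G] (A : Set G) (g h : G) : ℝ :=
  (wordLength A (g⁻¹ * h) : ℝ)

/-- The Gromov product `(x|y)_p` with respect to a distance function `d`. -/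
noncomputable def gromov {X : Type*} (d : X → X → ℝ) (p x y : X) : ℝ :=
  (d p x + d p y - d x y) / 2

/-- `G` is `δ`-hyperbolic with respect to the generating set `A`. -/
def IsHyperbolicWith [Group G] (A : Set G) (δ : ℝ) : Prop :=
  ∀ p g₀ g₁ g₂ : G,
    min (gromov (wordDist A) p g₀ g₁) (gromov (wordDist A) p g₁ g₂) - δ ≤
      gromov (wordDist A) p g₀ g₂

/-- `G` is hyperbolic with respect to the generating set `A`. -/
def IsHyperbolic [Group G] (A : Set G) : Prop :=
  ∃ δ : ℝ, 0 ≤ δ ∧ IsHyperbolicWith A δ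

/-- `ρ_{p,γ}(g,h) = e^{-γ (g|h)_p}` (and `0` on the diagonal), with respect to a
distance function `dA`. -/
noncomputable def visualRhoOf {X : Type*} (dA : X → X → ℝ) (p : X) (γ : ℝ) (g h : X) : ℝ :=
  if g = h then 0 else Real.exp (-γ * gromov dA p g h)

/-- `d` is a metric on `X`. -/
structure IsMetric {X : Type*} (d : X → X → ℝ) : Prop where
  refl : ∀ x, d x x = 0
  eq_of : ∀ x y, d x y = 0 → x = y
  symm : ∀ x y, d x y = d y x
  triangle : ∀ x y z, d x z ≤ d x y + d y z

/-- `d` is a visual metric in `V(p,γ,T)` with respect to the distance function `dA`. -/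
def InVisualOf {X : Type*} (dA : X → X → ℝ) (p : X) (γ T : ℝ) (d : X → X → ℝ) : Prop :=
  IsMetric d ∧ ∀ g h : X, g ≠ h →
    visualRhoOf dA p γ g h / T ≤ d g h ∧ d g h ≤ T * visualRhoOf dA p γ g h

/-- `d ∈ V^A(p,γ,T)`: `d` is a visual metric with respect to the word metric `d_A`. -/
def InVisual [Group G] (A : Set G) (p : G) (γ T : ℝ) (d : G → G → ℝ) : Prop :=
  InVisualOf (wordDist A) p γ T d

/-- `φ : (X,d) → (X,d')` satisfies a Hölder condition of exponent `r`. -/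
def HolderCondWith {X : Type*} (d d' : X → X → ℝ) (φ : X → X) (r : ℝ) : Prop :=
  ∃ K : ℝ, 0 < K ∧ ∀ g h : X, d' (φ g) (φ h) ≤ K * d g h ^ r

/-- `φ : (X,d) → (X,d')` satisfies a Hölder condition (of some positive exponent). -/
def SatisfiesHolder {X : Type*} (d d' : X → X → ℝ) (φ : X → X) : Prop :=
  ∃ r : ℝ, 0 < r ∧ HolderCondWith d d' φ r

/-- `φ : (X,d) → (X,d')` satisfies a Lipschitz condition. -/
def LipschitzCond {X : Type*} (d d' : X → X → ℝ) (φ : X → X) : Prop :=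
  ∃ K : ℝ, 0 < K ∧ ∀ g h : X, d' (φ g) (φ h) ≤ K * d g h

/-- `φ : (X,d) → (X,d')` is uniformly continuous. -/
def UnifCont {X : Type*} (d d' : X → X → ℝ) (φ : X → X) : Prop :=
  ∀ ε : ℝ, 0 < ε → ∃ δ : ℝ, 0 < δ ∧ ∀ g h : X, d g h < δ → d' (φ g) (φ h) < ε

/-- `φ : (X,d) → (X,d')` is a quasi-isometric embedding. -/
def QIEmbedding {X : Type*} (d d' : X → X → ℝ) (φ : X → X) : Prop :=
  ∃ lam K : ℝ, 1 ≤ lam ∧ 0 ≤ K ∧ ∀ g h : X,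
    (1 / lam) * d g h - K ≤ d' (φ g) (φ h) ∧ d' (φ g) (φ h) ≤ lam * d g h + K

/-- `H` is a quasiconvex subset of `G` with respect to the generating set `A`:
every geodesic word-metric chain joining two points of `H` stays at bounded
distance from `H`. -/
def IsQuasiconvex [Group G] (A : Set G) (H : Set G) : Prop :=
  ∃ q : ℝ, 0 ≤ q ∧ ∀ h ∈ H, ∀ h' ∈ H, ∀ n : ℕ, ∀ g : ℕ → G,
    g 0 = h → g n = h' → (n : ℝ) = wordDist A h h' →
    (∀ i < n, wordDist A (g i) (g (i + 1)) = 1) →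
    ∀ i ≤ n, ∃ z ∈ H, wordDist A (g i) z ≤ q

end Defs

/-- The sum `ρ(x₀,x₁) + ⋯ + ρ(x_{n-1},x_n)` along a chain `x₀,…,x_n`. -/
noncomputable def chainSum {X : Type*} (ρ : X → X → ℝ) : List X → ℝ
  | [] => 0
  | [_] => 0
  | x :: y :: t => ρ x y + chainSum ρ (y :: t)

/-- The visual metric `σ^A_{p,γ}(g,h)`: the infimum of chain sums of
`ρ^A_{p,γ}` over all chains from `g` to `h`. -/
noncomputable def visualSigma {G : Type*} [Group G] (A : Set G) (p : G) (γ : ℝ)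
    (g h : G) : ℝ :=
  sInf {s : ℝ | ∃ l : List G, l.head? = some g ∧ l.getLast? = some h ∧
    s = chainSum (visualRhoOf (wordDist A) p γ) l}

theorem wordLength_mul_le {G : Type*} [Group G] {A : Set G}
    (hA : Subgroup.closure A = ⊤) (g h : G) :
    wordLength A (g * h) ≤ wordLength A g + wordLength A h := by
  have attained : ∀ g : G, ∃ w : List G, w.length = wordLength A g ∧
      (∀ x ∈ w, x ∈ A ∨ x⁻¹ ∈ A) ∧ w.prod = g := fun g => by
    have hg : g ∈ Submonoid.closure (A ∪ A⁻¹) := by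
      simp [← Subgroup.closure_toSubmonoid, hA]
    obtain ⟨w, hw, hp⟩ := Submonoid.exists_list_of_mem_closure hg
    exact Nat.sInf_mem (s := {n : ℕ | ∃ w : List G, w.length = n ∧
      (∀ x ∈ w, x ∈ A ∨ x⁻¹ ∈ A) ∧ w.prod = g}) ⟨w.length, w, rfl, hw, hp⟩
  obtain ⟨u, hul, hu, hup⟩ := attained g
  obtain ⟨v, hvl, hv, hvp⟩ := attained h
  refine Nat.sInf_le ⟨u ++ v, by simp [hul, hvl], fun x hx => ?_, by simp [hup, hvp]⟩
  exact (List.mem_append.1 hx).elim (hu x) (hv x)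

theorem wordDist_triangle {G : Type*} [Group G] {A : Set G}
    (hA : Subgroup.closure A = ⊤) (x y z : G) :
    wordDist A x z ≤ wordDist A x y + wordDist A y z := by
  have := wordLength_mul_le hA (x⁻¹ * y) (y⁻¹ * z)
  rw [show x⁻¹ * y * (y⁻¹ * z) = x⁻¹ * z by group] at this
  unfold wordDist
  exact_mod_cast this

theorem gromov_mul_left_le {G : Type*} [Group G] {A : Set G}
    (hA : Subgroup.closure A = ⊤) (p g h k : G) :
    gromov (wordDist A) p (g * k) h ≤ gromov (wordDist A) p g h + wordLength A k := by
  have h1 := wordDist_triangle hA p g (g * k)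
  have h2 := wordDist_triangle hA g (g * k) h
  have h3 : wordDist A g (g * k) = wordLength A k := by simp [wordDist]
  unfold gromov
  linarith

/-- **Frink's chain lemma**: if `ρ` satisfies the quasi-ultrametric inequality with constant `2`,
then along a chain of at least two steps, `ρ` between the endpoints is at most twice the sum in
which the two extreme steps have weight `1` and all the others weight `2`. -/
theorem quasi_ultrametric_chain_le {X : Type*} {ρ : X → X → ℝ} (h0 : ∀ x y, 0 ≤ ρ x y)
    (hρ : ∀ x y z, ρ x z ≤ 2 * max (ρ x y) (ρ y z)) (x : ℕ → X) (n a : ℕ) :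
    ρ (x a) (x (a + n + 2)) ≤
      2 * (2 * ∑ i ∈ Finset.Ico a (a + n + 2), ρ (x i) (x (i + 1))
        - ρ (x a) (x (a + 1)) - ρ (x (a + n + 1)) (x (a + n + 2))) := by
  induction n using Nat.strong_induction_on generalizing a with
  | _ n ih =>
  have ends : ρ (x a) (x (a + 1)) + ρ (x (a + n + 1)) (x (a + n + 2)) ≤
      ∑ i ∈ Finset.Ico a (a + n + 2), ρ (x i) (x (i + 1)) := by
    rw [Finset.sum_Ico_succ_top (by lia), Finset.sum_eq_sum_Ico_succ_bot (by lia)]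
    linarith [Finset.sum_nonneg fun i (_ : i ∈ Finset.Ico (a + 1) (a + n + 1)) =>
      h0 (x i) (x (i + 1))]
  have hfirst := h0 (x a) (x (a + 1))
  have hlast := h0 (x (a + n + 1)) (x (a + n + 2))
  by_cases hend : ρ (x a) (x (a + n + 2)) ≤ 2 * ρ (x (a + n + 1)) (x (a + n + 2))
  · linarith
  have hex : ∃ m, ¬ ρ (x a) (x (a + n + 2)) ≤ 2 * ρ (x (a + m)) (x (a + n + 2)) :=
    ⟨n + 1, hend⟩
  have hle : Nat.find hex ≤ n + 1 := Nat.find_min' hex hend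
  have hspec := Nat.find_spec hex
  have hmin := fun m => Nat.find_min hex (m := m)
  generalize Nat.find hex = m at hle hspec hmin
  have hleft : ρ (x a) (x (a + n + 2)) ≤ 2 * ρ (x a) (x (a + m)) := by
    have := hρ (x a) (x (a + m)) (x (a + n + 2))
    rcases max_choice (ρ (x a) (x (a + m))) (ρ (x (a + m)) (x (a + n + 2))) with h | h
    · rwa [h] at this
    · rw [h] at this
      exact absurd this hspec
  match m, hle, hspec, hmin, hleft with
  | 0, _, hspec, _, _ =>
    exact absurd (by simpa using by linarith [h0 (x a) (x (a + n + 2))]) hspec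
  | 1, _, _, _, hleft => linarith
  | j + 2, hle, _, hmin, hleft =>
    have hright := not_not.1 (hmin (j + 1) (by lia))
    obtain ⟨k, rfl⟩ : ∃ k, n = j + 1 + k := ⟨n - (j + 1), by lia⟩
    have ih1 := ih j (by lia) a
    have ih2 := ih k (by lia) (a + (j + 1))
    have split := Finset.sum_Ico_consecutive (fun i => ρ (x i) (x (i + 1)))
      (show a ≤ a + (j + 1) by lia) (show a + (j + 1) ≤ a + (j + 1) + k + 2 by lia)
    have top := Finset.sum_Ico_succ_top (show a ≤ a + (j + 1) by lia)
      (fun i => ρ (x i) (x (i + 1)))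
    rw [show a + (j + 1) + k + 2 = a + (j + 1 + k) + 2 by lia,
      show a + (j + 1) + k + 1 = a + (j + 1 + k) + 1 by lia] at ih2
    rw [show a + (j + 1) + k + 2 = a + (j + 1 + k) + 2 by lia] at split
    simp only [← Nat.add_assoc] at *
    linarith

theorem exists_seq_of_chainSum {X : Type*} (ρ : X → X → ℝ) (l : List X) (g h : X)
    (hg : l.head? = some g) (hh : l.getLast? = some h) :
    ∃ (n : ℕ) (x : ℕ → X), x 0 = g ∧ x n = h ∧
      chainSum ρ l = ∑ i ∈ Finset.range n, ρ (x i) (x (i + 1)) := by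
  induction l generalizing g with
  | nil => simp at hg
  | cons a t ih =>
    obtain rfl : a = g := by simpa using hg
    cases t with
    | nil =>
      obtain rfl : a = h := by simpa using hh
      exact ⟨0, fun _ => a, rfl, rfl, by simp [chainSum]⟩
    | cons b t =>
      obtain ⟨n, x, hx0, hxn, hx⟩ := ih b rfl (by simpa using hh)
      refine ⟨n + 1, fun i => Nat.casesOn i a x, rfl, hxn, ?_⟩
      rw [Finset.sum_range_succ', chainSum, hx, ← hx0, add_comm]
      rfl

theorem le_four_mul_chainSum {X : Type*} {ρ : X → X → ℝ} (h0 : ∀ x y, 0 ≤ ρ x y)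
    (hself : ∀ x, ρ x x = 0) (hρ : ∀ x y z, ρ x z ≤ 2 * max (ρ x y) (ρ y z))
    (l : List X) (g h : X) (hg : l.head? = some g) (hh : l.getLast? = some h) :
    ρ g h ≤ 4 * chainSum ρ l := by
  obtain ⟨n, x, rfl, rfl, hsum⟩ := exists_seq_of_chainSum ρ l g h hg hh
  rw [hsum]
  match n with
  | 0 => simp [hself]
  | 1 =>
    simp only [Finset.sum_range_one]
    linarith [h0 (x 0) (x (0 + 1))]
  | n + 2 =>
    have := quasi_ultrametric_chain_le h0 hρ x n 0
    simp only [Nat.zero_add, ← Finset.range_eq_Ico] at this ⊢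
    linarith [h0 (x 0) (x 1), h0 (x (n + 1)) (x (n + 2))]

theorem chainSum_nonneg {X : Type*} {ρ : X → X → ℝ} (h0 : ∀ x y, 0 ≤ ρ x y) :
    ∀ l : List X, 0 ≤ chainSum ρ l
  | [] => le_rfl
  | [_] => le_rfl
  | x :: y :: t => add_nonneg (h0 x y) (chainSum_nonneg h0 (y :: t))

theorem visualRhoOf_nonneg {X : Type*} (d : X → X → ℝ) (p : X) (γ : ℝ) (g h : X) :
    0 ≤ visualRhoOf d p γ g h := by
  unfold visualRhoOf
  split_ifs <;> positivity

theorem visualRhoOf_le_two_mul_max {G : Type*} [Group G] {A : Set G} {δ γ : ℝ}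
    (hhyp : IsHyperbolicWith A δ) (hγ : 0 < γ) (hγδ : γ * δ ≤ Real.log 2) (p x y z : G) :
    visualRhoOf (wordDist A) p γ x z ≤
      2 * max (visualRhoOf (wordDist A) p γ x y) (visualRhoOf (wordDist A) p γ y z) := by
  have h0 := visualRhoOf_nonneg (wordDist A) p γ
  by_cases hxz : x = z
  · subst hxz
    rw [visualRhoOf, if_pos rfl]
    exact mul_nonneg zero_le_two (le_max_of_le_left (h0 x y))
  by_cases hxy : x = y
  · subst hxy
    linarith [h0 x z, le_max_right (visualRhoOf (wordDist A) p γ x x)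
      (visualRhoOf (wordDist A) p γ x z)]
  by_cases hyz : y = z
  · subst hyz
    linarith [h0 x y, le_max_left (visualRhoOf (wordDist A) p γ x y)
      (visualRhoOf (wordDist A) p γ y y)]
  have bound : ∀ t : ℝ, t - δ ≤ gromov (wordDist A) p x z →
      Real.exp (-γ * gromov (wordDist A) p x z) ≤ 2 * Real.exp (-γ * t) := fun t ht => by
    have hexp : -γ * gromov (wordDist A) p x z ≤ Real.log 2 + -γ * t := by nlinarith
    simpa only [Real.exp_add, Real.exp_log two_pos] using Real.exp_le_exp.2 hexp
  have hmin := hhyp p x y z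
  simp only [visualRhoOf, if_neg hxz, if_neg hxy, if_neg hyz]
  rcases min_choice (gromov (wordDist A) p x y) (gromov (wordDist A) p y z) with h | h
  · exact (bound _ (h ▸ hmin)).trans (by gcongr; exact le_max_left _ _)
  · exact (bound _ (h ▸ hmin)).trans (by gcongr; exact le_max_right _ _)

theorem visualSigma_nonneg {G : Type*} [Group G] (A : Set G) (p : G) (γ : ℝ) (g h : G) :
    0 ≤ visualSigma A p γ g h := by
  refine Real.sInf_nonneg ?_
  rintro _ ⟨l, -, -, rfl⟩
  exact chainSum_nonneg (visualRhoOf_nonneg _ p γ) l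

theorem visualSigma_le_visualRhoOf {G : Type*} [Group G] (A : Set G) (p : G) (γ : ℝ) (g h : G) :
    visualSigma A p γ g h ≤ visualRhoOf (wordDist A) p γ g h := by
  refine csInf_le ⟨0, ?_⟩ ⟨[g, h], rfl, rfl, by simp [chainSum]⟩
  rintro _ ⟨l, -, -, rfl⟩
  exact chainSum_nonneg (visualRhoOf_nonneg _ p γ) l

theorem visualRhoOf_le_four_mul_visualSigma {G : Type*} [Group G] {A : Set G} {δ γ : ℝ}
    (hhyp : IsHyperbolicWith A δ) (hγ : 0 < γ) (hγδ : γ * δ ≤ Real.log 2) (p g h : G) :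
    visualRhoOf (wordDist A) p γ g h ≤ 4 * visualSigma A p γ g h := by
  suffices visualRhoOf (wordDist A) p γ g h / 4 ≤ visualSigma A p γ g h by linarith
  refine le_csInf ⟨_, [g, h], rfl, rfl, rfl⟩ ?_
  rintro _ ⟨l, hg, hh, rfl⟩
  linarith [le_four_mul_chainSum (visualRhoOf_nonneg (wordDist A) p γ)
    (fun x => by simp [visualRhoOf]) (visualRhoOf_le_two_mul_max hhyp hγ hγδ p) l g h hg hh]

theorem visualRhoOf_rpow {X : Type*} (d : X → X → ℝ) (p : X) (γ r : ℝ) {g h : X}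
    (hgh : g ≠ h) :
    visualRhoOf d p γ g h ^ r = Real.exp (-(r * γ) * gromov d p g h) := by
  rw [visualRhoOf, if_neg hgh, ← Real.exp_mul]
  ring_nf

/-- For a nontrivial homomorphism `φ` of a hyperbolic group and `r > 0`,
a Hölder condition of exponent `r` with respect to `σ^A_{p,γ}`, `σ^{A'}_{p',γ'}` is
equivalent to a linear lower bound of Gromov products. -/
theorem stmt_2 {G : Type*} [Group G] (A A' : Set G)
    (hAfin : A.Finite) (hA'fin : A'.Finite)
    (hAgen : Subgroup.closure A = ⊤) (hA'gen : Subgroup.closure A' = ⊤)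
    (δ δ' : ℝ) (hδ : 0 ≤ δ) (hδ' : 0 ≤ δ')
    (hhyp : IsHyperbolicWith A δ) (hhyp' : IsHyperbolicWith A' δ')
    (γ γ' : ℝ) (hγ : 0 < γ) (hγ' : 0 < γ')
    (hγδ : γ * δ ≤ Real.log 2) (hγδ' : γ' * δ' ≤ Real.log 2)
    (p p' : G) (φ : G →* G) (hnt : ∃ g : G, φ g ≠ 1) (r : ℝ) (hr : 0 < r) :
    HolderCondWith (visualSigma A p γ) (visualSigma A' p' γ') ⇑φ r ↔
      ∃ Q : ℝ, ∀ g h : G,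
        gromov (wordDist A) p g h ≤
          γ' / (r * γ) * gromov (wordDist A') p' (φ g) (φ h) + Q := by
  have hrγ : 0 < r * γ := mul_pos hr hγ
  constructor
  · rintro ⟨K, hK, hHol⟩
    obtain ⟨k, hk⟩ := hnt
    have key : ∀ g h : G, φ g ≠ φ h → gromov (wordDist A) p g h ≤
        γ' / (r * γ) * gromov (wordDist A') p' (φ g) (φ h) + Real.log (4 * K) / (r * γ) := by
      intro g h hne
      have hgh : g ≠ h := fun e => hne (e ▸ rfl)
      have hlow := visualRhoOf_le_four_mul_visualSigma hhyp' hγ' hγδ' p' (φ g) (φ h)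
      have hup := Real.rpow_le_rpow (visualSigma_nonneg A p γ g h)
        (visualSigma_le_visualRhoOf A p γ g h) hr.le
      rw [visualRhoOf_rpow _ _ _ _ hgh] at hup
      rw [visualRhoOf, if_neg hne] at hlow
      have hexp : Real.exp (-γ' * gromov (wordDist A') p' (φ g) (φ h)) ≤
          Real.exp (Real.log (4 * K) + -(r * γ) * gromov (wordDist A) p g h) := by
        rw [Real.exp_add, Real.exp_log (by positivity)]
        nlinarith [hHol g h, mul_le_mul_of_nonneg_left hup hK.le]
      have hlin := Real.exp_le_exp.1 hexp
      rw [div_mul_eq_mul_div, ← add_div, le_div_iff₀ hrγ]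
      linarith
    refine ⟨γ' / (r * γ) * wordLength A' (φ k) + wordLength A k⁻¹ +
      |Real.log (4 * K) / (r * γ)|, fun g h => ?_⟩
    have habs := le_abs_self (Real.log (4 * K) / (r * γ))
    have hcoef : 0 ≤ γ' / (r * γ) := by positivity
    by_cases hne : φ g = φ h
    · have h1 := key (g * k) h (by simpa [hne] using hk)
      have h2 := gromov_mul_left_le hAgen p (g * k) h k⁻¹
      have h3 := mul_le_mul_of_nonneg_left
        (gromov_mul_left_le hA'gen p' (φ g) (φ h) (φ k)) hcoef
      rw [mul_inv_cancel_right] at h2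
      rw [map_mul] at h1
      linarith
    · have h1 := key g h hne
      have h2 : 0 ≤ γ' / (r * γ) * (wordLength A' (φ k) : ℝ) := by positivity
      have h3 : (0 : ℝ) ≤ wordLength A k⁻¹ := Nat.cast_nonneg _
      linarith
  · rintro ⟨Q, hQ⟩
    refine ⟨Real.exp (r * γ * Q) * 4 ^ r, by positivity, fun g h => ?_⟩
    have hσ := visualSigma_nonneg A p γ g h
    refine (visualSigma_le_visualRhoOf A' p' γ' (φ g) (φ h)).trans ?_
    by_cases hne : φ g = φ h
    · rw [visualRhoOf, if_pos hne]
      positivity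
    have hgh : g ≠ h := fun e => hne (e ▸ rfl)
    have hlow := Real.rpow_le_rpow (visualRhoOf_nonneg _ _ _ _ _)
      (visualRhoOf_le_four_mul_visualSigma hhyp hγ hγδ p g h) hr.le
    rw [visualRhoOf_rpow _ _ _ _ hgh, Real.mul_rpow (by norm_num) hσ] at hlow
    rw [visualRhoOf, if_neg hne, mul_assoc]
    refine le_trans ?_ (mul_le_mul_of_nonneg_left hlow (Real.exp_pos _).le)
    rw [← Real.exp_add, Real.exp_le_exp]
    have hmul := mul_le_mul_of_nonneg_left (hQ g h) hrγ.le
    rw [mul_add, ← mul_assoc, mul_div_cancel₀ _ hrγ.ne'] at hmul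
    linarith
end

section
/- Let (X,d) be a geodesic metric space, let x₀, x₁, …, x_n ∈ X, set s_k = Σ_{i=1}^k d(x_{i−1},x_i) and s = s_n, and let ξ : [0,s] → X be a map whose restriction to each interval [s_{k−1}, s_k] is an isometric embedding with s_{k−1}ξ = x_{k−1} and s_kξ = x_k. Suppose there are constants P, L > 0 and Q ≥ 0 such that 1 ≤ d(x_{i−1},x_i) ≤ L for all i ∈ {1,…,n} and P·d(x_i,x_j) + Q ≥ |i − j| for all i,j ∈ {0,…,n}. Then for all u,v ∈ [0,s]: |u−v|/(LP) − (Q+1)/P − L ≤ d(uξ, vξ) ≤ |u−v| + 2L; in particular ξ is a (λ,K)-quasigeodesic for λ = max{1, LP} and K = max{2L, (Q+1)/P + L}. -/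
/-- A point of `[S 0, S n]` lies in one of the intervals `[S k, S (k + 1)]`. -/
theorem exists_mem_Icc_succ (S : ℕ → ℝ) {n : ℕ} (hn : 0 < n) {u : ℝ}
    (hu : u ∈ Set.Icc (S 0) (S n)) : ∃ k < n, u ∈ Set.Icc (S k) (S (k + 1)) := by
  induction n, hn using Nat.le_induction with
  | base => exact ⟨0, by norm_num, hu⟩
  | succ n hn ih =>
    rcases le_total u (S n) with h | h
    · obtain ⟨k, hk, hk'⟩ := ih ⟨hu.1, h⟩
      exact ⟨k, by omega, hk'⟩
    · exact ⟨n, by omega, h, hu.2⟩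

/-- A point on a broken geodesic whose steps have length at most `L` is within `L / 2` of a
vertex, both in the parameter and in the space. -/
theorem exists_vertex_near {X : Type*} [MetricSpace X] {n : ℕ} (hn : 0 < n) {x : ℕ → X}
    {ξ : ℝ → X} {S : ℕ → ℝ} {L : ℝ}
    (hseg : ∀ k < n, (∀ u ∈ Set.Icc (S k) (S (k + 1)), ∀ v ∈ Set.Icc (S k) (S (k + 1)),
        dist (ξ u) (ξ v) = |u - v|) ∧ ξ (S k) = x k ∧ ξ (S (k + 1)) = x (k + 1))
    (hlen : ∀ k < n, S (k + 1) - S k ≤ L) {u : ℝ} (hu : u ∈ Set.Icc (S 0) (S n)) :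
    ∃ p ≤ n, |u - S p| ≤ L / 2 ∧ dist (ξ u) (x p) ≤ L / 2 := by
  obtain ⟨k, hk, hku⟩ := exists_mem_Icc_succ S hn hu
  obtain ⟨hiso, hl, hr⟩ := hseg k hk
  have hle := hku.1.trans hku.2
  have hkL := hlen k hk
  rcases le_total (u - S k) (S (k + 1) - u) with h | h
  · have hd : |u - S k| ≤ L / 2 := by
      rw [abs_of_nonneg (by linarith [hku.1])]
      linarith
    refine ⟨k, hk.le, hd, ?_⟩
    rwa [← hl, hiso u hku _ ⟨le_rfl, hle⟩]
  · have hd : |u - S (k + 1)| ≤ L / 2 := by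
      rw [abs_of_nonpos (by linarith [hku.2])]
      linarith
    refine ⟨k + 1, hk, hd, ?_⟩
    rwa [← hr, hiso u hku _ ⟨hle, le_rfl⟩]

/-- Partial sums of the step lengths dominate distances between vertices, and grow at most
linearly when the steps have length at most `L`. -/
theorem dist_le_abs_sub_partialSum_and_le {X : Type*} [MetricSpace X] {n : ℕ} {x : ℕ → X}
    {S : ℕ → ℝ} {L : ℝ} (hS : ∀ k, S (k + 1) = S k + dist (x k) (x (k + 1)))
    (hstep : ∀ k < n, dist (x k) (x (k + 1)) ≤ L) {p q : ℕ} (hp : p ≤ n) (hq : q ≤ n) :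
    dist (x p) (x q) ≤ |S p - S q| ∧ |S p - S q| ≤ L * |(p : ℝ) - q| := by
  wlog hpq : p ≤ q generalizing p q
  · have := this hq hp (le_of_not_ge hpq)
    rwa [dist_comm, abs_sub_comm (S q), abs_sub_comm (q : ℝ)] at this
  have key : dist (x p) (x q) ≤ S q - S p ∧ S q - S p ≤ L * ((q : ℝ) - p) := by
    induction q, hpq using Nat.le_induction with
    | base => simp
    | succ q hpq ih =>
      obtain ⟨h₁, h₂⟩ := ih (by omega)
      have h₃ := hstep q (by omega)
      have h₄ := dist_triangle (x p) (x q) (x (q + 1))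
      rw [hS q]
      push_cast
      constructor <;> linarith
  rw [abs_sub_comm, abs_of_nonneg (dist_nonneg.trans key.1), abs_sub_comm (p : ℝ),
    abs_of_nonneg (sub_nonneg.2 (Nat.cast_le.2 hpq))]
  exact key

/-- In a geodesic metric space, a piecewise-geodesic path through points
`x₀,…,x_n` whose steps have length in `[1,L]` and which satisfies
`P·d(x_i,x_j) + Q ≥ |i-j|` is a `(max{1,LP}, max{2L,(Q+1)/P+L})`-quasigeodesic; more
precisely `|u-v|/(LP) - (Q+1)/P - L ≤ d(uξ,vξ) ≤ |u-v| + 2L`. -/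
theorem stmt_3 {X : Type*} [MetricSpace X]
    (hgeodesic : ∀ a b : X, ∃ f : ℝ → X, f 0 = a ∧ f (dist a b) = b ∧
      ∀ u ∈ Set.Icc (0 : ℝ) (dist a b), ∀ v ∈ Set.Icc (0 : ℝ) (dist a b),
        dist (f u) (f v) = |u - v|)
    (n : ℕ) (x : ℕ → X) (ξ : ℝ → X) (S : ℕ → ℝ)
    (hS : ∀ k : ℕ, S k = ∑ i ∈ Finset.range k, dist (x i) (x (i + 1)))
    (hseg : ∀ k < n, (∀ u ∈ Set.Icc (S k) (S (k + 1)), ∀ v ∈ Set.Icc (S k) (S (k + 1)),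
        dist (ξ u) (ξ v) = |u - v|) ∧ ξ (S k) = x k ∧ ξ (S (k + 1)) = x (k + 1))
    (P L Q : ℝ) (hP : 0 < P) (hL : 0 < L) (hQ : 0 ≤ Q)
    (hstep : ∀ i < n, 1 ≤ dist (x i) (x (i + 1)) ∧ dist (x i) (x (i + 1)) ≤ L)
    (hlow : ∀ i ≤ n, ∀ j ≤ n, |(i : ℝ) - (j : ℝ)| ≤ P * dist (x i) (x j) + Q) :
    ∀ u ∈ Set.Icc (0 : ℝ) (S n), ∀ v ∈ Set.Icc (0 : ℝ) (S n),
      (|u - v| / (L * P) - (Q + 1) / P - L ≤ dist (ξ u) (ξ v) ∧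
        dist (ξ u) (ξ v) ≤ |u - v| + 2 * L) ∧
      ((1 / max 1 (L * P)) * |u - v| - max (2 * L) ((Q + 1) / P + L) ≤ dist (ξ u) (ξ v) ∧
        dist (ξ u) (ξ v) ≤ max 1 (L * P) * |u - v| + max (2 * L) ((Q + 1) / P + L)) := by
  intro u hu v hv
  have hS0 : S 0 = 0 := by simp [hS]
  have hSsucc : ∀ k, S (k + 1) = S k + dist (x k) (x (k + 1)) := fun k => by
    rw [hS, hS, Finset.sum_range_succ]
  have hQP : 0 ≤ (Q + 1) / P := by positivity
  have hLP : 0 < L * P := by positivity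
  have main : |u - v| / (L * P) - (Q + 1) / P - L ≤ dist (ξ u) (ξ v) ∧
      dist (ξ u) (ξ v) ≤ |u - v| + 2 * L := by
    rcases Nat.eq_zero_or_pos n with rfl | hn
    · rw [hS0] at hu hv
      obtain rfl : u = v := by linarith [hu.1, hu.2, hv.1, hv.2]
      simp only [sub_self, abs_zero, zero_div, dist_self]
      constructor <;> linarith
    have hlen : ∀ k < n, S (k + 1) - S k ≤ L := fun k hk => by
      linarith [hSsucc k, (hstep k hk).2]
    rw [← hS0] at hu hv
    obtain ⟨p, hp, hup, hxp⟩ := exists_vertex_near hn hseg hlen hu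
    obtain ⟨q, hq, hvq, hxq⟩ := exists_vertex_near hn hseg hlen hv
    obtain ⟨h₁, h₂⟩ :=
      dist_le_abs_sub_partialSum_and_le hSsucc (fun k hk => (hstep k hk).2) hp hq
    have hpq := hlow p hp q hq
    have h₃ : |u - v| ≤ |S p - S q| + L := by
      have a₁ := abs_sub_le u (S p) v
      have a₂ := abs_sub_le (S p) (S q) v
      rw [abs_sub_comm (S q) v] at a₂
      linarith
    have h₄ : |S p - S q| ≤ |u - v| + L := by
      have a₁ := abs_sub_le (S p) u (S q)
      have a₂ := abs_sub_le u v (S q)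
      rw [abs_sub_comm (S p) u] at a₁
      linarith
    have h₅ := dist_triangle4 (ξ u) (x p) (x q) (ξ v)
    have h₆ := dist_triangle4 (x p) (ξ u) (ξ v) (x q)
    rw [dist_comm (x q)] at h₅
    rw [dist_comm (x p) (ξ u)] at h₆
    refine ⟨?_, by linarith⟩
    have h₇ : |u - v| / (L * P) - (Q + 1) / P ≤ dist (x p) (x q) := by
      have h₈ : |u - v| ≤ L * (P * dist (x p) (x q) + Q + 1) := by
        nlinarith [mul_le_mul_of_nonneg_left hpq hL.le]
      rw [sub_le_iff_le_add, div_le_iff₀ hLP]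
      calc |u - v| ≤ L * (P * dist (x p) (x q) + Q + 1) := h₈
        _ = (dist (x p) (x q) + (Q + 1) / P) * (L * P) := by field_simp; ring
    linarith
  refine ⟨main, ?_, ?_⟩
  · have h : 1 / max 1 (L * P) * |u - v| ≤ |u - v| / (L * P) := by
      rw [one_div_mul_eq_div]
      gcongr
      exact le_max_right _ _
    linarith [main.1, le_max_right (2 * L) ((Q + 1) / P + L)]
  · have h := mul_le_mul_of_nonneg_right (le_max_left 1 (L * P)) (abs_nonneg (u - v))
    linarith [main.2, le_max_left (2 * L) ((Q + 1) / P + L)]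
end

section
/- Let G be a hyperbolic group endowed with a visual metric d, and let φ be an endomorphism of G with Gφ ≠ {1} which is uniformly continuous as a map from (G,d) to (G,d). Then φ is virtually injective, i.e. the kernel of φ is finite. -/
open scoped Classical

theorem exists_word_of_closure_eq_top {G : Type*} [Group G] {A : Set G}
    (hA : Subgroup.closure A = ⊤) (g : G) :
    ∃ w : List G, w.length = wordLength A g ∧ (∀ x ∈ w, x ∈ A ∨ x⁻¹ ∈ A) ∧ w.prod = g := by
  have hg : g ∈ Submonoid.closure (A ∪ A⁻¹) := by
    rw [← Subgroup.closure_toSubmonoid, hA]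
    exact Subgroup.mem_top g
  obtain ⟨w, hw, rfl⟩ := Submonoid.exists_list_of_mem_closure hg
  exact Nat.sInf_mem (s := {n : ℕ | ∃ v : List G, v.length = n ∧
    (∀ x ∈ v, x ∈ A ∨ x⁻¹ ∈ A) ∧ v.prod = w.prod}) ⟨w.length, w, rfl, hw, rfl⟩

/-- Balls in the word metric of a finite generating set are finite. -/
theorem finite_setOf_wordLength_le {G : Type*} [Group G] {A : Set G} (hfin : A.Finite)
    (hA : Subgroup.closure A = ⊤) (N : ℕ) : {g : G | wordLength A g ≤ N}.Finite := by
  have hS : (A ∪ A⁻¹).Finite := hfin.union hfin.inv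
  have : Finite ↥(A ∪ A⁻¹) := hS
  refine ((List.finite_length_le ↥(A ∪ A⁻¹) N).image
    fun l => (l.map Subtype.val).prod).subset fun g hg => ?_
  obtain ⟨w, hlen, hw, hprod⟩ := exists_word_of_closure_eq_top hA g
  lift w to List ↥(A ∪ A⁻¹) using hw
  refine ⟨w, ?_, hprod⟩
  rw [List.length_map] at hlen
  exact hlen.le.trans hg

/-- Right translation by `g` moves the points far from `p` by a small visual distance:
a lower bound on `d k (k * g)` bounds the distance from `k` to `p`. -/
theorem wordLength_le_of_le_visual_dist {G : Type*} [Group G] {A : Set G} {p : G} {γ T : ℝ}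
    (hγ : 0 < γ) (hT : 1 ≤ T) {d : G → G → ℝ} (hd : InVisual A p γ T d) {δ : ℝ} (hδ : 0 < δ)
    {g k : G} (hg : g ≠ 1) (h : δ ≤ d k (k * g)) :
    (wordLength A (p⁻¹ * k) : ℝ) ≤ 2 * (Real.log (T / δ) / γ) + wordLength A g := by
  have hne : k ≠ k * g := fun e => hg (left_eq_mul.mp e)
  have hle := h.trans (hd.2 k (k * g) hne).2
  rw [visualRhoOf, if_neg hne] at hle
  have hT0 : 0 < T := by linarith
  have hlog : Real.log (δ / T) ≤ -γ * gromov (wordDist A) p k (k * g) := by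
    rw [Real.log_le_iff_le_exp (by positivity), div_le_iff₀' hT0]
    exact hle
  have hM : gromov (wordDist A) p k (k * g) ≤ Real.log (T / δ) / γ := by
    rw [le_div_iff₀ hγ, ← inv_div δ T, Real.log_inv]
    linarith
  have hpos : (0 : ℝ) ≤ wordLength A (p⁻¹ * (k * g)) := Nat.cast_nonneg _
  simp only [gromov, wordDist, inv_mul_cancel_left] at hM
  linarith

/-- A nontrivial uniformly continuous endomorphism of a hyperbolic group
(with respect to a visual metric) has finite kernel. -/
theorem stmt_5 {G : Type*} [Group G] (A : Set G)
    (hAfin : A.Finite) (hAgen : Subgroup.closure A = ⊤) (hhyp : IsHyperbolic A)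
    (p : G) (γ T : ℝ) (hγ : 0 < γ) (hT : 1 ≤ T)
    (d : G → G → ℝ) (hd : InVisual A p γ T d)
    (φ : G →* G) (hnt : ∃ g : G, φ g ≠ 1)
    (huc : UnifCont d d ⇑φ) :
    {g : G | φ g = 1}.Finite := by
  obtain ⟨g, hg⟩ := hnt
  have hε : 0 < d 1 (φ g) := by
    have hnn : 0 ≤ d 1 (φ g) := by
      have h := hd.1.triangle 1 (φ g) 1
      rw [hd.1.refl, hd.1.symm (φ g) 1] at h
      linarith
    exact hnn.lt_of_ne fun h => hg (hd.1.eq_of _ _ h.symm).symm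
  obtain ⟨δ, hδ, hunif⟩ := huc _ hε
  have hg1 : g ≠ 1 := by
    rintro rfl
    exact hg φ.map_one
  refine ((finite_setOf_wordLength_le hAfin hAgen
    ⌊2 * (Real.log (T / δ) / γ) + wordLength A g⌋₊).image (p * ·)).subset fun k hk => ?_
  refine ⟨p⁻¹ * k, Nat.le_floor ?_, mul_inv_cancel_left p k⟩
  refine wordLength_le_of_le_visual_dist hγ hT hd hδ hg1 (not_lt.mp fun h => ?_)
  have hφ := hunif k (k * g) h
  rw [map_mul, show φ k = 1 from hk, one_mul] at hφ
  exact lt_irrefl _ hφ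
end
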